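/- Every connected graph G on n vertices admits a universal set of proper 4-tuples of size O(n^2). More precisely, there exists a set U of proper 4-tuples of vertices of G with |U| ≤ C·n^2 for an absolute constant C, such that for every 2-join (X1, X2) of G, some 4-tuple of U is compatible with (X1, X2). -/

import Mathlib

open SimpleGraph Set

/-- `(X1, X2, A1, B1, A2, B2)` is a split of a 2-join of `G`. -/
def IsTwoJoinSplit {V : Type*} (G : SimpleGraph V) (X1 X2 A1 B1 A2 B2 : Set V) : Prop :=
  X1 ∪ X2 = Set.univ ∧ Disjoint X1 X2 ∧
  A1 ⊆ X1 ∧ B1 ⊆ X1 ∧ A2 ⊆ X2 ∧ B2 ⊆ X2 ∧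
  Disjoint A1 B1 ∧ Disjoint A2 B2 ∧
  A1.Nonempty ∧ B1.Nonempty ∧ A2.Nonempty ∧ B2.Nonempty ∧
  (∀ a1 ∈ A1, ∀ a2 ∈ A2, G.Adj a1 a2) ∧
  (∀ b1 ∈ B1, ∀ b2 ∈ B2, G.Adj b1 b2) ∧
  (∀ x ∈ X1, ∀ y ∈ X2, G.Adj x y → (x ∈ A1 ∧ y ∈ A2) ∨ (x ∈ B1 ∧ y ∈ B2)) ∧
  3 ≤ X1.ncard ∧ 3 ≤ X2.ncard

/-- `(X1, X2)` is a 2-join of `G`. -/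
def IsTwoJoin {V : Type*} (G : SimpleGraph V) (X1 X2 : Set V) : Prop :=
  ∃ A1 B1 A2 B2, IsTwoJoinSplit G X1 X2 A1 B1 A2 B2

/-- `(a1, a2, b1, b2)` is a proper 4-tuple of `G`. -/
def ProperQuad {V : Type*} (G : SimpleGraph V) (a1 a2 b1 b2 : V) : Prop :=
  a1 ≠ a2 ∧ a1 ≠ b1 ∧ a1 ≠ b2 ∧ a2 ≠ b1 ∧ a2 ≠ b2 ∧ b1 ≠ b2 ∧
  G.Adj a1 a2 ∧ G.Adj b1 b2 ∧ ¬ G.Adj a1 b2 ∧ ¬ G.Adj b1 a2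

/-- `G[X]` is a chordless path with one end in `A`, the other end in `B`,
and interior in `X \ (A ∪ B)`. -/
def IsPathSide {V : Type*} (G : SimpleGraph V) (X A B : Set V) : Prop :=
  ∃ (k : ℕ) (f : Fin (k+1) → V), Function.Injective f ∧
    X = Set.range f ∧ f 0 ∈ A ∧ f (Fin.last k) ∈ B ∧
    (∀ i : Fin (k+1), i ≠ 0 → i ≠ Fin.last k → f i ∉ A ∪ B) ∧
    (∀ i j : Fin (k+1), G.Adj (f i) (f j) ↔ ((i : ℕ) + 1 = (j : ℕ) ∨ (j : ℕ) + 1 = (i : ℕ)))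

/-- `(X1, X2)` is a path 2-join of `G`: it has a split one of whose sides is a path-side. -/
def IsPathTwoJoin {V : Type*} (G : SimpleGraph V) (X1 X2 : Set V) : Prop :=
  ∃ A1 B1 A2 B2, IsTwoJoinSplit G X1 X2 A1 B1 A2 B2 ∧
    (IsPathSide G X1 A1 B1 ∨ IsPathSide G X2 A2 B2)

/-- A non-path 2-join is a 2-join that is not a path 2-join. -/
def IsNonPathTwoJoin {V : Type*} (G : SimpleGraph V) (X1 X2 : Set V) : Prop :=
  IsTwoJoin G X1 X2 ∧ ¬ IsPathTwoJoin G X1 X2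

/-- Every graph has a parent map whose arcs meet every cut crossed by some edge. -/
lemma SimpleGraph.exists_parent_map_crossing {V : Type*} (H : SimpleGraph V) :
    ∃ p : V → V, ∀ S : Set V, ∀ x y, x ∈ S → y ∉ S → H.Adj x y →
      ∃ v, H.Adj v (p v) ∧ ((v ∈ S ∧ p v ∉ S) ∨ (p v ∈ S ∧ v ∉ S)) := by
  have hrep : ∀ v, H.Reachable v (H.connectedComponentMk v).out := fun v =>
    ConnectedComponent.exact (Quot.out_eq _).symm
  have hstep : ∀ v, ∃ w, v ≠ (H.connectedComponentMk v).out →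
      H.Adj v w ∧ H.dist w (H.connectedComponentMk v).out
        < H.dist v (H.connectedComponentMk v).out := by
    intro v
    by_cases hv : v = (H.connectedComponentMk v).out
    · exact ⟨v, fun h => absurd hv h⟩
    · obtain ⟨q, hq⟩ := (hrep v).exists_walk_length_eq_dist
      obtain ⟨w, hw, q', rfl⟩ := Walk.exists_eq_cons_of_ne hv q
      refine ⟨w, fun _ => ⟨hw, ?_⟩⟩
      have := dist_le q'
      simp only [Walk.length_cons] at hq
      omega
  choose p hp using hstep
  refine ⟨p, fun S x y hx hy hxy => ?_⟩
  by_contra! hno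
  have key : ∀ n v, H.dist v (H.connectedComponentMk v).out ≤ n →
      (v ∈ S ↔ (H.connectedComponentMk v).out ∈ S) := by
    intro n
    induction n with
    | zero =>
      intro v hv
      rw [← (hrep v).dist_eq_zero_iff.1 (Nat.le_zero.1 hv)]
    | succ n ih =>
      intro v hv
      by_cases hvr : v = (H.connectedComponentMk v).out
      · rw [← hvr]
      · obtain ⟨hadj, hlt⟩ := hp v hvr
        have hc : H.connectedComponentMk v = H.connectedComponentMk (p v) :=
          ConnectedComponent.sound hadj.reachable
        have h1 := ih (p v) (by rw [← hc]; omega)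
        rw [hc, ← h1]
        have h2 := hno v hadj
        tauto
  have hc : H.connectedComponentMk x = H.connectedComponentMk y :=
    ConnectedComponent.sound hxy.reachable
  have h1 := key _ x le_rfl
  have h2 := key _ y le_rfl
  rw [hc] at h1
  tauto

section Auxiliary

variable {V : Type*} (G : SimpleGraph V)

/-- Edges `x y` avoiding the common neighbours of `s` and `t`, and such that, if `s x y t` is an
induced square, then the level of `x` is at most that of `s`. -/
def edgeCandidates (ℓ : V → ℕ) (s t : V) : SimpleGraph V where
  Adj x y := G.Adj x y ∧ ¬ (G.Adj s x ∧ G.Adj t x) ∧ ¬ (G.Adj s y ∧ G.Adj t y) ∧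
    ¬ (G.Adj s x ∧ G.Adj t y ∧ ℓ s < ℓ x) ∧ ¬ (G.Adj s y ∧ G.Adj t x ∧ ℓ s < ℓ y)
  symm := ⟨fun _ _ h => ⟨h.1.symm, h.2.2.1, h.2.1, h.2.2.2.2, h.2.2.2.1⟩⟩
  loopless := ⟨fun _ h => G.irrefl h.1⟩

/-- Pairs of distinct nonadjacent common neighbours of `g` and `v`. -/
def nonedgeCandidates (g v : V) : SimpleGraph V where
  Adj x y := x ≠ y ∧ ¬ G.Adj x y ∧ G.Adj g x ∧ G.Adj v x ∧ G.Adj g y ∧ G.Adj v y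
  symm := ⟨fun _ _ h => ⟨h.1.symm, fun e => h.2.1 e.symm, h.2.2.2.2.1, h.2.2.2.2.2,
    h.2.2.1, h.2.2.2.1⟩⟩
  loopless := ⟨fun _ h => h.1 rfl⟩

/-- `p` is the parent map of a breadth-first search tree with level function `ℓ`. -/
structure IsLevelTree (ℓ : V → ℕ) (p : V → V) : Prop where
  le_succ : ∀ u v, G.Adj u v → ℓ v ≤ ℓ u + 1
  adj_parent : ∀ v, ℓ v ≠ 0 → G.Adj (p v) v
  level_parent : ∀ v, ℓ v ≠ 0 → ℓ (p v) + 1 = ℓ v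

/-- Some tree edge or some grandparent pair has a candidate crossing the cut `(X1, X2)`, and each
of its crossing candidates completes it to a proper 4-tuple. -/
def HasCrossingCandidate (ℓ : V → ℕ) (p : V → V) (X1 X2 : Set V) : Prop :=
  (∃ t ∈ X2, p t ∈ X1 ∧
    (∃ x ∈ X1, ∃ y ∈ X2, (edgeCandidates G ℓ (p t) t).Adj x y) ∧
    ∀ x ∈ X1, ∀ y ∈ X2, (edgeCandidates G ℓ (p t) t).Adj x y → ProperQuad G (p t) t x y) ∨
  (∃ v ∈ X2, p (p v) ∈ X1 ∧
    (∃ x ∈ X1, ∃ y ∈ X2, (nonedgeCandidates G (p (p v)) v).Adj x y) ∧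
    ∀ x ∈ X1, ∀ y ∈ X2, (nonedgeCandidates G (p (p v)) v).Adj x y →
      ProperQuad G (p (p v)) y x v)

end Auxiliary

section Split

variable {V : Type*} {G : SimpleGraph V} {X1 X2 A1 B1 A2 B2 : Set V}

lemma IsTwoJoinSplit.swap_ends (h : IsTwoJoinSplit G X1 X2 A1 B1 A2 B2) :
    IsTwoJoinSplit G X1 X2 B1 A1 B2 A2 := by
  obtain ⟨hu, hd, hA1, hB1, hA2, hB2, d1, d2, nA1, nB1, nA2, nB2, cA, cB, hX, c1, c2⟩ := h
  exact ⟨hu, hd, hB1, hA1, hB2, hA2, d1.symm, d2.symm, nB1, nA1, nB2, nA2, cB, cA,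
    fun x hx y hy e => (hX x hx y hy e).symm, c1, c2⟩

lemma IsTwoJoinSplit.swap_sides (h : IsTwoJoinSplit G X1 X2 A1 B1 A2 B2) :
    IsTwoJoinSplit G X2 X1 A2 B2 A1 B1 := by
  obtain ⟨hu, hd, hA1, hB1, hA2, hB2, d1, d2, nA1, nB1, nA2, nB2, cA, cB, hX, c1, c2⟩ := h
  refine ⟨by rw [Set.union_comm, hu], hd.symm, hA2, hB2, hA1, hB1, d2, d1, nA2, nB2, nA1, nB1,
    fun a ha b hb => (cA b hb a ha).symm, fun a ha b hb => (cB b hb a ha).symm,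
    fun x hx y hy e => ?_, c2, c1⟩
  have := hX y hy x hx e.symm
  tauto

lemma IsTwoJoinSplit.not_adj_left_right (h : IsTwoJoinSplit G X1 X2 A1 B1 A2 B2) {x y : V}
    (hx : x ∈ A1) (hy : y ∈ B2) : ¬ G.Adj x y := by
  obtain ⟨-, -, hA1, -, -, hB2, d1, d2, -, -, -, -, -, -, hX, -, -⟩ := h
  intro e
  rcases hX x (hA1 hx) y (hB2 hy) e with h | h
  · exact Set.disjoint_left.1 d2 h.2 hy
  · exact Set.disjoint_left.1 d1 hx h.1

lemma IsTwoJoinSplit.properQuad (h : IsTwoJoinSplit G X1 X2 A1 B1 A2 B2) {a1 a2 b1 b2 : V}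
    (ha1 : a1 ∈ A1) (ha2 : a2 ∈ A2) (hb1 : b1 ∈ B1) (hb2 : b2 ∈ B2) :
    ProperQuad G a1 a2 b1 b2 := by
  have n1 := h.not_adj_left_right ha1 hb2
  have n2 := h.swap_ends.not_adj_left_right hb1 ha2
  obtain ⟨-, hd, hA1, hB1, hA2, hB2, d1, d2, -, -, -, -, cA, cB, -, -, -⟩ := h
  exact ⟨(cA a1 ha1 a2 ha2).ne, fun e => Set.disjoint_left.1 d1 ha1 (e ▸ hb1),
    fun e => Set.disjoint_left.1 hd (hA1 ha1) (e ▸ hB2 hb2),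
    fun e => Set.disjoint_left.1 hd (hB1 hb1) (e ▸ hA2 ha2),
    fun e => Set.disjoint_left.1 d2 ha2 (e ▸ hb2), (cB b1 hb1 b2 hb2).ne,
    cA a1 ha1 a2 ha2, cB b1 hb1 b2 hb2, n1, n2⟩

lemma IsTwoJoinSplit.hasCrossingCandidate_of_parent
    (h : IsTwoJoinSplit G X1 X2 A1 B1 A2 B2) {ℓ : V → ℕ} {p : V → V} {t b1 b2 : V}
    (hs : p t ∈ A1) (ht : t ∈ A2) (hlev : ∀ a ∈ A2, ℓ (p t) < ℓ a)
    (hb1 : b1 ∈ B1) (hb2 : b2 ∈ B2)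
    (hb : ¬ (G.Adj (p t) b1 ∧ G.Adj t b2 ∧ ℓ (p t) < ℓ b1)) :
    HasCrossingCandidate G ℓ p X1 X2 := by
  have n1 := h.not_adj_left_right hs hb2
  have n2 := h.swap_ends.not_adj_left_right hb1 ht
  have hprop := fun x y => h.properQuad (b1 := x) (b2 := y) hs ht
  obtain ⟨-, hd, hA1, hB1, hA2, hB2, d1, d2, -, -, -, -, cA, cB, hX, -, -⟩ := h
  refine Or.inl ⟨t, hA2 ht, hA1 hs, ⟨b1, hB1 hb1, b2, hB2 hb2, cB _ hb1 _ hb2,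
    fun e => n2 e.2.symm, fun e => n1 e.1, hb, fun e => n1 e.1⟩, ?_⟩
  rintro x hx y hy ⟨e, -, -, -, e4⟩
  rcases hX x hx y hy e with h | h
  · exact absurd ⟨cA _ hs _ h.2, (cA _ h.1 _ ht).symm, hlev _ h.2⟩ e4
  · exact hprop x y h.1 h.2

lemma IsTwoJoinSplit.hasCrossingCandidate_of_grandparent
    (h : IsTwoJoinSplit G X1 X2 A1 B1 A2 B2) {ℓ : V → ℕ} {p : V → V} {v b1 a2 : V}
    (hg : p (p v) ∈ A1) (hv : v ∈ B2) (hb1 : b1 ∈ B1) (ha2 : a2 ∈ A2)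
    (hgb : G.Adj (p (p v)) b1) (hva : G.Adj v a2) :
    HasCrossingCandidate G ℓ p X1 X2 := by
  have n2 := h.swap_ends.not_adj_left_right hb1 ha2
  have hgv := h.not_adj_left_right hg hv
  have hprop := fun x y => h.properQuad (a2 := y) (b1 := x) hg (hb2 := hv)
  obtain ⟨-, hd, hA1, hB1, hA2, hB2, d1, d2, -, -, -, -, cA, cB, hX, -, -⟩ := h
  refine Or.inr ⟨v, hB2 hv, hA1 hg, ⟨b1, hB1 hb1, a2, hA2 ha2,
    fun e => Set.disjoint_left.1 hd (hB1 hb1) (e ▸ hA2 ha2), n2, hgb,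
    (cB _ hb1 _ hv).symm, cA _ hg _ ha2, hva⟩, ?_⟩
  rintro x hx y hy ⟨-, -, -, hvx, hgy, -⟩
  have h1 := hX x hx v (hB2 hv) hvx.symm
  have h2 := hX _ (hA1 hg) y hy hgy
  have hvA : v ∉ A2 := fun e => Set.disjoint_left.1 d2 e hv
  have hgB : p (p v) ∉ B1 := Set.disjoint_left.1 d1 hg
  exact hprop x y (by tauto) (by tauto)

lemma IsTwoJoinSplit.hasCrossingCandidate_of_min_level
    (h : IsTwoJoinSplit G X1 X2 A1 B1 A2 B2) {ℓ : V → ℕ} {p : V → V} (hT : IsLevelTree G ℓ p)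
    (hr : ∀ v ∈ X2, ℓ v ≠ 0) {a : V} (ha : a ∈ A2) (hmin : ∀ v ∈ X2, ℓ a ≤ ℓ v) :
    HasCrossingCandidate G ℓ p X1 X2 := by
  by_contra hno
  have hP := fun t b1 b2 => h.hasCrossingCandidate_of_parent (p := p) (ℓ := ℓ) (t := t)
    (b1 := b1) (b2 := b2)
  have hQ := fun t a1 a2 => h.swap_ends.hasCrossingCandidate_of_parent (p := p) (ℓ := ℓ)
    (t := t) (b1 := a1) (b2 := a2)
  have hR := fun v b1 a2 => h.hasCrossingCandidate_of_grandparent (p := p) (ℓ := ℓ) (v := v)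
    (b1 := b1) (a2 := a2)
  obtain ⟨hu, -, -, -, hA2, hB2, -, d2, -, ⟨b1, hb1⟩, -, ⟨b2, hb2⟩, cA, -, hX, -, -⟩ := h
  have hside : ∀ v, v ∉ X2 → v ∈ X1 := fun v hv =>
    (hu ▸ Set.mem_univ v : v ∈ X1 ∪ X2).resolve_right hv
  have hpar : ∀ v ∈ X2, ℓ v ≤ ℓ a → (p v ∈ A1 ∧ v ∈ A2) ∨ (p v ∈ B1 ∧ v ∈ B2) := by
    intro v hv hle
    have h1 := hT.level_parent v (hr v hv)
    refine hX _ (hside _ fun hc => ?_) v hv (hT.adj_parent v (hr v hv))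
    have := hmin _ hc
    omega
  have hparA : ∀ v ∈ A2, ℓ v ≤ ℓ a → p v ∈ A1 := fun v hv hle =>
    ((hpar v (hA2 hv) hle).resolve_right fun e => Set.disjoint_left.1 d2 hv e.2).1
  have hlevA : ∀ v ∈ A2, ℓ v ≤ ℓ a := fun v hv => by
    have h1 := hT.le_succ _ _ (cA _ (hparA a ha le_rfl) v hv)
    have h2 := hT.level_parent a (hr a (hA2 ha))
    omega
  -- otherwise every tree edge between `A1` and `A2` forms a square with every `B1`-`B2` edge
  have hsq : ∀ t ∈ A2, ∀ b1 ∈ B1, ∀ b2 ∈ B2,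
      G.Adj (p t) b1 ∧ G.Adj t b2 ∧ ℓ (p t) < ℓ b1 := by
    intro t ht b1 hb1 b2 hb2
    by_contra hb
    refine hno (hP t b1 b2 (hparA t ht (hlevA t ht)) ht (fun v hv => ?_) hb1 hb2 hb)
    have h1 := hT.level_parent t (hr t (hA2 ht))
    have h2 := hlevA t ht
    have h3 := hmin v (hA2 hv)
    omega
  have hra := hT.level_parent a (hr a (hA2 ha))
  have hlevB1 : ∀ v ∈ B1, ℓ v = ℓ a := fun v hv => by
    have h1 := hsq a ha v hv b2 hb2
    have h2 := hT.le_succ _ _ h1.1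
    omega
  have hlevB2 : ∀ v ∈ B2, ℓ v = ℓ a + 1 := fun v hv => by
    have h1 := hT.le_succ _ _ (hsq a ha b1 hb1 v hv).2.1
    have h2 := hmin v (hB2 hv)
    by_contra hne
    have h3 := (hpar v (hB2 hv) (by omega)).resolve_left
      fun e => Set.disjoint_left.1 d2 e.2 hv
    have h4 := hlevB1 _ h3.1
    have h5 := hT.level_parent v (hr v (hB2 hv))
    omega
  have hb2r := hr b2 (hB2 hb2)
  have hlev := hT.level_parent b2 hb2r
  have hadj := hT.adj_parent b2 hb2r
  have hl2 := hlevB2 b2 hb2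
  by_cases hp : p b2 ∈ X2
  · rcases hpar _ hp (by omega) with ⟨hg, hpA⟩ | ⟨-, hpB⟩
    · exact hno (hR b2 b1 (p b2) hg hb2 hb1 hpA (hsq _ hpA b1 hb1 b2 hb2).1 hadj.symm)
    · have := hlevB2 _ hpB
      omega
  · rcases hX _ (hside _ hp) b2 (hB2 hb2) hadj with h | h
    · exact Set.disjoint_left.1 d2 h.2 hb2
    · refine hno (hQ b2 (p a) a h.1 hb2 (fun v hv => ?_) (hparA a ha le_rfl) ha ?_)
      · have := hlevB2 v hv
        omega
      · rintro ⟨-, -, h3⟩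
        omega

lemma IsTwoJoinSplit.hasCrossingCandidate
    (h : IsTwoJoinSplit G X1 X2 A1 B1 A2 B2) {ℓ : V → ℕ} {p : V → V} (hT : IsLevelTree G ℓ p)
    (hr : ∀ v ∈ X2, ℓ v ≠ 0) : HasCrossingCandidate G ℓ p X1 X2 := by
  have hne : X2.Nonempty := by
    obtain ⟨-, -, -, -, hA2, -, -, -, -, -, nA2, -⟩ := h
    exact nA2.mono hA2
  obtain ⟨u, hu, hmin⟩ : ∃ u ∈ X2, ∀ v ∈ X2, ℓ u ≤ ℓ v := by
    obtain ⟨u, hu, hle⟩ := (InvImage.wf ℓ Nat.lt_wfRel.wf).has_min X2 hne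
    exact ⟨u, hu, fun v hv => not_lt.1 (hle v hv)⟩
  have hlev := hT.level_parent u (hr u hu)
  have hpu : p u ∈ X1 := by
    have : p u ∈ X1 ∪ X2 := h.1 ▸ Set.mem_univ _
    refine this.resolve_right fun hc => ?_
    have := hmin _ hc
    omega
  obtain ⟨-, -, -, -, -, -, -, -, -, -, -, -, -, -, hX, -, -⟩ := id h
  rcases hX _ hpu u hu (hT.adj_parent u (hr u hu)) with hA | hB
  · exact h.hasCrossingCandidate_of_min_level hT hr hA.2 hmin
  · exact h.swap_ends.hasCrossingCandidate_of_min_level hT hr hB.2 hmin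

end Split

lemma SimpleGraph.Connected.exists_isLevelTree {V : Type*} {G : SimpleGraph V}
    (hG : G.Connected) (r : V) : ∃ p, IsLevelTree G (G.dist r) p := by
  have hstep : ∀ v, ∃ w, G.dist r v ≠ 0 → G.Adj w v ∧ G.dist r w + 1 = G.dist r v := by
    intro v
    by_cases hv : v = r
    · exact ⟨v, fun h => absurd (hv ▸ dist_self) h⟩
    · obtain ⟨q, hq⟩ := (hG v r).exists_walk_length_eq_dist
      obtain ⟨w, hw, q', rfl⟩ := Walk.exists_eq_cons_of_ne hv q
      refine ⟨w, fun _ => ⟨hw.symm, ?_⟩⟩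
      have h1 := dist_le q'
      have h2 := hG.dist_triangle (u := v) (v := w) (w := r)
      rw [dist_eq_one_iff_adj.2 hw] at h2
      simp only [Walk.length_cons] at hq
      rw [dist_comm, dist_comm (u := r) (v := v)]
      omega
  choose p hp using hstep
  refine ⟨p, fun u v huv => ?_, fun v hv => (hp v hv).1, fun v hv => (hp v hv).2⟩
  have := hG.dist_triangle (u := r) (v := u) (w := v)
  rwa [dist_eq_one_iff_adj.2 huv] at this

/-- Every 2-join with `r` on its first side has a compatible 4-tuple in some quadratic set. -/
lemma SimpleGraph.Connected.exists_universal_of_mem_left {V : Type*} [Fintype V]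
    {G : SimpleGraph V} (hG : G.Connected) (r : V) :
    ∃ U : Finset (V × V × V × V),
      U.card ≤ 4 * (Fintype.card V) ^ 2 ∧
      (∀ q ∈ U, ProperQuad G q.1 q.2.1 q.2.2.1 q.2.2.2) ∧
      (∀ X1 X2 : Set V, r ∈ X1 → IsTwoJoin G X1 X2 →
        ∃ q ∈ U, q.1 ∈ X1 ∧ q.2.2.1 ∈ X1 ∧ q.2.1 ∈ X2 ∧ q.2.2.2 ∈ X2) := by
  classical
  obtain ⟨p, hT⟩ := hG.exists_isLevelTree r
  choose f hf using fun t => (edgeCandidates G (G.dist r) (p t) t).exists_parent_map_crossing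
  choose g hg using fun v => (nonedgeCandidates G (p (p v)) v).exists_parent_map_crossing
  let quads : (Bool × Bool) × V × V → V × V × V × V
    | ((true, true), t, x) => (p t, t, x, f t x)
    | ((true, false), t, x) => (p t, t, f t x, x)
    | ((false, true), v, x) => (p (p v), g v x, x, v)
    | ((false, false), v, x) => (p (p v), x, g v x, v)
  refine ⟨(Finset.univ.image quads).filter fun q => ProperQuad G q.1 q.2.1 q.2.2.1 q.2.2.2,
    ?_, fun q hq => (Finset.mem_filter.1 hq).2, ?_⟩
  · refine (Finset.card_filter_le _ _).trans (Finset.card_image_le.trans (le_of_eq ?_))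
    simp [pow_two]
  · rintro X1 X2 hr ⟨A1, B1, A2, B2, h⟩
    have hmem : ∀ i, ProperQuad G (quads i).1 (quads i).2.1 (quads i).2.2.1 (quads i).2.2.2 →
        quads i ∈ (Finset.univ.image quads).filter
          fun q => ProperQuad G q.1 q.2.1 q.2.2.1 q.2.2.2 := fun i hi =>
      Finset.mem_filter.2 ⟨Finset.mem_image_of_mem _ (Finset.mem_univ i), hi⟩
    have hside : ∀ v, v ∉ X1 → v ∈ X2 := fun v hv =>
      (h.1 ▸ Set.mem_univ v : v ∈ X1 ∪ X2).resolve_left hv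
    have hdisj : ∀ v ∈ X2, v ∉ X1 := fun v hv hv' => Set.disjoint_left.1 h.2.1 hv' hv
    have hroot : ∀ v ∈ X2, G.dist r v ≠ 0 := fun v hv e =>
      hdisj v hv (hG.dist_eq_zero_iff.1 e ▸ hr)
    rcases h.hasCrossingCandidate hT hroot with
      ⟨t, ht, hs, ⟨x, hx, y, hy, hxy⟩, hall⟩ | ⟨v, hv, hs, ⟨x, hx, y, hy, hxy⟩, hall⟩
    · obtain ⟨z, hz, ⟨hz1, hz2⟩ | ⟨hz1, hz2⟩⟩ := hf t X1 x y hx (hdisj y hy) hxy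
      · exact ⟨_, hmem ((true, true), t, z) (hall _ hz1 _ (hside _ hz2) hz),
          hs, hz1, ht, hside _ hz2⟩
      · exact ⟨_, hmem ((true, false), t, z) (hall _ hz1 _ (hside _ hz2) hz.symm),
          hs, hz1, ht, hside _ hz2⟩
    · obtain ⟨z, hz, ⟨hz1, hz2⟩ | ⟨hz1, hz2⟩⟩ := hg v X1 x y hx (hdisj y hy) hxy
      · exact ⟨_, hmem ((false, true), v, z) (hall _ hz1 _ (hside _ hz2) hz),
          hs, hz1, hside _ hz2, hv⟩
      · exact ⟨_, hmem ((false, false), v, z) (hall _ hz1 _ (hside _ hz2) hz.symm),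
          hs, hz1, hside _ hz2, hv⟩

lemma ProperQuad.swap_sides {V : Type*} {G : SimpleGraph V} {a1 a2 b1 b2 : V}
    (h : ProperQuad G a1 a2 b1 b2) : ProperQuad G a2 a1 b2 b1 := by
  obtain ⟨h1, h2, h3, h4, h5, h6, h7, h8, h9, h10⟩ := h
  exact ⟨h1.symm, h5, h4, h3, h2, h6.symm, h7.symm, h8.symm, fun e => h10 e.symm,
    fun e => h9 e.symm⟩

theorem stmt_7 :
    ∃ C : ℕ, ∀ (V : Type) [Fintype V] (G : SimpleGraph V), G.Connected →
      ∃ U : Finset (V × V × V × V),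
        U.card ≤ C * (Fintype.card V) ^ 2 ∧
        (∀ q ∈ U, ProperQuad G q.1 q.2.1 q.2.2.1 q.2.2.2) ∧
        (∀ X1 X2 : Set V, IsTwoJoin G X1 X2 →
          ∃ q ∈ U, q.1 ∈ X1 ∧ q.2.2.1 ∈ X1 ∧ q.2.1 ∈ X2 ∧ q.2.2.2 ∈ X2) := by
  classical
  refine ⟨8, fun V _ G hG => ?_⟩
  obtain ⟨r⟩ := hG.nonempty
  obtain ⟨U, hcard, hprop, huniv⟩ := hG.exists_universal_of_mem_left r
  let σ : V × V × V × V → V × V × V × V := fun q => (q.2.1, q.1, q.2.2.2, q.2.2.1)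
  refine ⟨U ∪ U.image σ, ?_, fun q hq => ?_, fun X1 X2 hX => ?_⟩
  · have h1 := Finset.card_union_le U (U.image σ)
    have h2 := Finset.card_image_le (s := U) (f := σ)
    omega
  · rcases Finset.mem_union.1 hq with hq | hq
    · exact hprop q hq
    · obtain ⟨q', hq', rfl⟩ := Finset.mem_image.1 hq
      exact (hprop q' hq').swap_sides
  · by_cases hr : r ∈ X1
    · obtain ⟨q, hq, h⟩ := huniv X1 X2 hr hX
      exact ⟨q, Finset.mem_union_left _ hq, h⟩
    · obtain ⟨A1, B1, A2, B2, h⟩ := hX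
      have hr' : r ∈ X2 := (h.1 ▸ Set.mem_univ r : r ∈ X1 ∪ X2).resolve_left hr
      obtain ⟨q, hq, h1, h2, h3, h4⟩ := huniv X2 X1 hr' ⟨_, _, _, _, h.swap_sides⟩
      exact ⟨σ q, Finset.mem_union_right _ (Finset.mem_image_of_mem _ hq), h3, h4, h1, h2⟩
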